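/- Let n ≥ 1 and let f_1, …, f_n : ℝ^d → ℝ be differentiable convex functions whose gradients are L-Lipschitz (‖∇f_i(x) − ∇f_i(y)‖ ≤ L‖x − y‖ for all x, y) for some L > 0, let f = (1/n)∑_{i=1}^n f_i, and let x* be a global minimizer of f (so ∇f(x*) = 0). Then for all x, w ∈ ℝ^d, (1/n)·∑_{i=1}^n ‖∇f_i(x) − ∇f_i(w) + ∇f(w) − ∇f(x)‖² ≤ 4L·( f(x) − f(x*) + f(w) − f(x*) ). -/

import Mathlib

open scoped RealInnerProductSpace

section SmoothConvex

variable {E : Type*} [NormedAddCommGroup E] [InnerProductSpace ℝ E]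

theorem HasGradientAt.hasDerivAt_comp_line [CompleteSpace E] {f : E → ℝ} {g x v : E} {t : ℝ}
    (h : HasGradientAt f g (x + t • v)) :
    HasDerivAt (fun s : ℝ => f (x + s • v)) ⟪g, v⟫ t := by
  have hline : HasDerivAt (fun s : ℝ => x + s • v) v t := by
    simpa using ((hasDerivAt_id t).smul_const v).const_add x
  exact (h.hasFDerivAt.comp_hasDerivAt t hline).congr_deriv
    (InnerProductSpace.toDual_apply_apply ..)

/-- A convex function lies above its tangent hyperplanes. -/
theorem ConvexOn.add_inner_gradient_le [CompleteSpace E] {f : E → ℝ}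
    (hconv : ConvexOn ℝ Set.univ f) {y : E} (hf : DifferentiableAt ℝ f y) (x : E) :
    f y + ⟪gradient f y, x - y⟫ ≤ f x := by
  have hline : ConvexOn ℝ Set.univ (fun s : ℝ => f (y + s • (x - y))) := by
    simpa [Function.comp_def, AffineMap.lineMap_apply, add_comm] using
      hconv.comp_affineMap (AffineMap.lineMap y x : ℝ →ᵃ[ℝ] E)
  have hderiv : HasDerivAt (fun s : ℝ => f (y + s • (x - y))) ⟪gradient f y, x - y⟫ 0 :=
    HasGradientAt.hasDerivAt_comp_line (by simpa using hf.hasGradientAt)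
  have := hline.le_slope_of_hasDerivAt (Set.mem_univ 0) (Set.mem_univ 1) one_pos hderiv
  simp only [slope_def_field, one_smul, zero_smul, add_zero, sub_zero, div_one,
    add_sub_cancel] at this
  linarith

/-- The descent lemma: quadratic upper bound for a function with Lipschitz gradient. -/
theorem Differentiable.le_add_inner_gradient_add_sq [CompleteSpace E] {f : E → ℝ} {L : ℝ}
    (hf : Differentiable ℝ f)
    (hlip : ∀ x y, ‖gradient f x - gradient f y‖ ≤ L * ‖x - y‖) (x v : E) :
    f (x + v) ≤ f x + ⟪gradient f x, v⟫ + L / 2 * ‖v‖ ^ 2 := by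
  have hderiv (t : ℝ) : HasDerivAt
      (fun s : ℝ => f (x + s • v) - s * ⟪gradient f x, v⟫ - s ^ 2 * (L / 2 * ‖v‖ ^ 2))
      (⟪gradient f (x + t • v) - gradient f x, v⟫ - t * (L * ‖v‖ ^ 2)) t := by
    have h := (((hf (x + t • v)).hasGradientAt.hasDerivAt_comp_line).sub
      ((hasDerivAt_id t).mul_const ⟪gradient f x, v⟫)).sub
      ((hasDerivAt_pow 2 t).mul_const (L / 2 * ‖v‖ ^ 2))
    refine h.congr_deriv ?_
    rw [inner_sub_left]
    push_cast
    ring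
  have hanti := antitoneOn_of_deriv_nonpos (convex_Icc (0 : ℝ) 1)
    (fun t _ => (hderiv t).continuousAt.continuousWithinAt)
    (fun t _ => (hderiv t).differentiableAt.differentiableWithinAt) (by
      intro t ht
      rw [interior_Icc] at ht
      rw [(hderiv t).deriv, sub_nonpos]
      calc ⟪gradient f (x + t • v) - gradient f x, v⟫
          ≤ ‖gradient f (x + t • v) - gradient f x‖ * ‖v‖ := real_inner_le_norm _ _
        _ ≤ L * ‖x + t • v - x‖ * ‖v‖ := by gcongr; exact hlip _ _
        _ = t * (L * ‖v‖ ^ 2) := by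
          rw [add_sub_cancel_left, norm_smul, Real.norm_of_nonneg ht.1.le]
          ring)
  have := hanti (Set.left_mem_Icc.2 zero_le_one) (Set.right_mem_Icc.2 zero_le_one) zero_le_one
  simp only [one_smul, zero_smul, add_zero, one_mul, zero_mul, sub_zero, one_pow, ne_eq,
    OfNat.ofNat_ne_zero, not_false_eq_true, zero_pow] at this
  linarith

/-- For a convex function with `L`-Lipschitz gradient, the Bregman divergence controls the squared
distance between gradients. -/
theorem ConvexOn.norm_gradient_sub_sq_le [CompleteSpace E] {f : E → ℝ} {L : ℝ} (hL : 0 < L)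
    (hconv : ConvexOn ℝ Set.univ f) (hf : Differentiable ℝ f)
    (hlip : ∀ x y, ‖gradient f x - gradient f y‖ ≤ L * ‖x - y‖) (x y : E) :
    ‖gradient f x - gradient f y‖ ^ 2 ≤
      2 * L * (f x - f y - ⟪gradient f y, x - y⟫) := by
  set g := gradient f x - gradient f y with hg
  have hlower := hconv.add_inner_gradient_le (hf y) (x + (-L⁻¹) • g)
  have hupper := hf.le_add_inner_gradient_add_sq hlip x ((-L⁻¹) • g)
  rw [add_sub_right_comm, inner_add_right, real_inner_smul_right] at hlower
  rw [real_inner_smul_right, norm_smul, mul_pow, Real.norm_eq_abs, sq_abs] at hupper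
  have hgg : ⟪gradient f x, g⟫ - ⟪gradient f y, g⟫ = ‖g‖ ^ 2 := by
    rw [← inner_sub_left, ← hg, real_inner_self_eq_norm_sq]
  have hquad : L / 2 * ((-L⁻¹) ^ 2 * ‖g‖ ^ 2) = L⁻¹ * ‖g‖ ^ 2 / 2 := by
    field_simp
  have key : L⁻¹ * ‖g‖ ^ 2 ≤ 2 * (f x - f y - ⟪gradient f y, x - y⟫) := by
    have := congrArg (L⁻¹ * ·) hgg
    simp only [mul_sub] at this
    linarith
  calc ‖g‖ ^ 2 = L * (L⁻¹ * ‖g‖ ^ 2) := by field_simp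
    _ ≤ L * (2 * (f x - f y - ⟪gradient f y, x - y⟫)) := by gcongr
    _ = _ := by ring

theorem gradient_const_mul_sum [CompleteSpace E] {ι : Type*} [Fintype ι] {f : ι → E → ℝ} (c : ℝ)
    {x : E} (hf : ∀ i, DifferentiableAt ℝ (f i) x) :
    gradient (fun y => c * ∑ i, f i y) x = c • ∑ i, gradient (f i) x := by
  apply HasGradientAt.gradient
  rw [hasGradientAt_iff_hasFDerivAt]
  have h := (HasFDerivAt.fun_sum (u := Finset.univ)
    fun i _ => (hf i).hasGradientAt.hasFDerivAt).const_mul c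
  simpa using h

/-- The mean squared deviation from the mean is at most the mean square. -/
theorem sum_norm_sub_mean_sq_le {ι : Type*} [Fintype ι] (g : ι → E) :
    ∑ i, ‖g i - (1 / (Fintype.card ι : ℝ)) • ∑ j, g j‖ ^ 2 ≤ ∑ i, ‖g i‖ ^ 2 := by
  rcases isEmpty_or_nonempty ι
  · simp
  set m := (1 / (Fintype.card ι : ℝ)) • ∑ j, g j with hm
  have hsum : ∑ i, g i = (Fintype.card ι : ℝ) • m := by
    rw [hm, smul_smul, mul_one_div_cancel (by simp), one_smul]
  have h : ∑ i, ‖g i - m‖ ^ 2 = ∑ i, ‖g i‖ ^ 2 - Fintype.card ι * ‖m‖ ^ 2 := by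
    simp_rw [norm_sub_sq_real, Finset.sum_add_distrib, Finset.sum_sub_distrib, ← Finset.mul_sum,
      ← sum_inner, hsum, real_inner_smul_left, real_inner_self_eq_norm_sq]
    simp
    ring
  rw [h]
  exact sub_le_self _ (by positivity)

theorem norm_sub_sq_le_two_mul (a b : E) : ‖a - b‖ ^ 2 ≤ 2 * ‖a‖ ^ 2 + 2 * ‖b‖ ^ 2 := by
  have := parallelogram_law_with_norm ℝ a b
  nlinarith [sq_nonneg ‖a + b‖]

end SmoothConvex

/-- Variance bound for the SVRG gradient estimator in terms of function value gaps:
`(1/n) ∑ᵢ ‖∇fᵢ(x) − ∇fᵢ(w) + ∇f(w) − ∇f(x)‖² ≤ 4L (f(x) − f(x*) + f(w) − f(x*))`. -/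
theorem svrg_variance_function_gap_bound {d n : ℕ} (hn : 1 ≤ n)
    (f : Fin n → EuclideanSpace ℝ (Fin d) → ℝ) (L : ℝ) (hL : 0 < L)
    (hdiff : ∀ i, Differentiable ℝ (f i))
    (hconv : ∀ i, ConvexOn ℝ Set.univ (f i))
    (hlip : ∀ i x y, ‖gradient (f i) x - gradient (f i) y‖ ≤ L * ‖x - y‖)
    (F : EuclideanSpace ℝ (Fin d) → ℝ)
    (hF : F = fun x => (1 / (n : ℝ)) * ∑ i, f i x)
    (xstar : EuclideanSpace ℝ (Fin d)) (hmin : ∀ y, F xstar ≤ F y) :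
    ∀ x w, (1 / (n : ℝ)) *
        ∑ i, ‖gradient (f i) x - gradient (f i) w + gradient F w - gradient F x‖ ^ 2 ≤
      4 * L * (F x - F xstar + F w - F xstar) := by
  have hgrad (x) : gradient F x = (1 / (n : ℝ)) • ∑ i, gradient (f i) x := by
    rw [hF]
    exact gradient_const_mul_sum _ fun i => hdiff i x
  have hstar : ∑ i, gradient (f i) xstar = 0 := by
    have hzero : gradient F xstar = 0 := by
      have : IsLocalMin F xstar := Filter.Eventually.of_forall hmin
      rw [gradient, this.fderiv_eq_zero, map_zero]
    rw [hgrad] at hzero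
    exact (smul_eq_zero.1 hzero).resolve_left (by positivity)
  have hgap (x) : (1 / (n : ℝ)) * ∑ i, ‖gradient (f i) x - gradient (f i) xstar‖ ^ 2 ≤
      2 * L * (F x - F xstar) := by
    calc (1 / (n : ℝ)) * ∑ i, ‖gradient (f i) x - gradient (f i) xstar‖ ^ 2
        ≤ (1 / (n : ℝ)) * ∑ i, 2 * L *
            (f i x - f i xstar - ⟪gradient (f i) xstar, x - xstar⟫) := by
          gcongr with i
          exact (hconv i).norm_gradient_sub_sq_le hL (hdiff i) (hlip i) x xstar
      _ = 2 * L * (F x - F xstar) := by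
          rw [← Finset.mul_sum, Finset.sum_sub_distrib, Finset.sum_sub_distrib, ← sum_inner,
            hstar, inner_zero_left, hF]
          ring
  intro x w
  have hvar : ∑ i, ‖gradient (f i) x - gradient (f i) w + gradient F w - gradient F x‖ ^ 2 ≤
      ∑ i, ‖gradient (f i) x - gradient (f i) w‖ ^ 2 := by
    have h := sum_norm_sub_mean_sq_le fun i => gradient (f i) x - gradient (f i) w
    simpa only [Fintype.card_fin, Finset.sum_sub_distrib, smul_sub, ← hgrad, ← sub_add,
      add_sub_right_comm] using h
  calc _ ≤ (1 / (n : ℝ)) * ∑ i, ‖gradient (f i) x - gradient (f i) w‖ ^ 2 := by gcongr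
    _ ≤ (1 / (n : ℝ)) * ∑ i, (2 * ‖gradient (f i) x - gradient (f i) xstar‖ ^ 2 +
          2 * ‖gradient (f i) w - gradient (f i) xstar‖ ^ 2) := by
        gcongr with i
        simpa using norm_sub_sq_le_two_mul (gradient (f i) x - gradient (f i) xstar)
          (gradient (f i) w - gradient (f i) xstar)
    _ = 2 * ((1 / (n : ℝ)) * ∑ i, ‖gradient (f i) x - gradient (f i) xstar‖ ^ 2) +
          2 * ((1 / (n : ℝ)) * ∑ i, ‖gradient (f i) w - gradient (f i) xstar‖ ^ 2) := by
        rw [Finset.sum_add_distrib, ← Finset.mul_sum, ← Finset.mul_sum]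
        ring
    _ ≤ _ := by linarith [hgap x, hgap w]
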